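/- arXiv:math/0307223 — 2 statements merged into one kernel-verified Lean document; each statement's English description precedes it below -/
import Mathlib

section
/- Let $S = K[x_1,\ldots,x_n]$ with $n \ge 2$ and let $I \subset S$ be a lexsegment ideal with $I_j \ne 0$ for some $j > 0$. Then the number of monomials $w \in I_j$ divisible by $x_n$ equals $H(S, j-1) - H(S/I, j)^{[j]}$, where $H(S, j-1) = \binom{n+j-2}{j-1}$ is the number of monomials of degree $j-1$, $H(S/I,j)$ is the Hilbert function of $S/I$ in degree $j$, and $a^{[j]}$ is defined via the $j$-th Macaulay representation $a = \sum_{i=1}^{j}\binom{k(i)}{i}$ by $a^{[j]} = \sum_{i=1}^{j}\binom{k(i)-1}{i-1}$. -/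
open MvPolynomial

variable {K : Type*} [Field K] {n : ℕ}

/-- The total degree of an exponent vector. -/
def mdeg {n : ℕ} (m : Fin n →₀ ℕ) : ℕ := m.sum fun _ e => e

/-- `I` is a monomial ideal: it contains every monomial of each of its elements. -/
def IsMonomialIdeal (I : Ideal (MvPolynomial (Fin n) K)) : Prop :=
  ∀ f ∈ I, ∀ m ∈ f.support, (monomial m (1 : K)) ∈ I

/-- `I` is stable: for every monomial `u ∈ I` with largest dividing variable `x_k`,
and every `i ≤ k`, the monomial `(x_i / x_k) * u` lies in `I`. -/
def IsStableIdeal (I : Ideal (MvPolynomial (Fin n) K)) : Prop :=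
  ∀ m : Fin n →₀ ℕ, (monomial m (1 : K)) ∈ I →
    ∀ k i : Fin n, m k ≠ 0 → (∀ k', k < k' → m k' = 0) → i ≤ k →
      (monomial (m + Finsupp.single i 1 - Finsupp.single k 1) (1 : K)) ∈ I

/-- `I` is strongly stable: for every monomial `u ∈ I`, every variable `x_k` dividing `u`
and every `i ≤ k`, the monomial `(x_i / x_k) * u` lies in `I`. -/
def IsStronglyStableIdeal (I : Ideal (MvPolynomial (Fin n) K)) : Prop :=
  ∀ m : Fin n →₀ ℕ, (monomial m (1 : K)) ∈ I →
    ∀ k i : Fin n, m k ≠ 0 → i ≤ k →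
      (monomial (m + Finsupp.single i 1 - Finsupp.single k 1) (1 : K)) ∈ I

/-- `v <_lex u` for exponent vectors, lex order with `x_1 > x_2 > ⋯ > x_n`. -/
def lexLt {n : ℕ} (v u : Fin n →₀ ℕ) : Prop :=
  ∃ i : Fin n, (∀ j < i, v j = u j) ∧ v i < u i

/-- `I` is a lexsegment ideal. -/
def IsLexsegmentIdeal (I : Ideal (MvPolynomial (Fin n) K)) : Prop :=
  IsMonomialIdeal I ∧
    ∀ u v : Fin n →₀ ℕ, (monomial u (1 : K)) ∈ I → mdeg v = mdeg u → lexLt u v →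
      (monomial v (1 : K)) ∈ I

/-- The degree `j` piece of `S/I`, as the image of the degree `j` homogeneous polynomials. -/
noncomputable def Qpiece (I : Ideal (MvPolynomial (Fin n) K)) (j : ℕ) :
    Submodule K (MvPolynomial (Fin n) K ⧸ I) :=
  (homogeneousSubmodule (Fin n) K j).map (Ideal.Quotient.mkₐ K I).toLinearMap

/-- Multiplication by `g` maps `(S/I)_j` injectively (to `(S/I)_{j'}`). -/
def QInj (I : Ideal (MvPolynomial (Fin n) K)) (g : MvPolynomial (Fin n) K)
    (j _j' : ℕ) : Prop :=
  ∀ f₁ ∈ Qpiece I j, ∀ f₂ ∈ Qpiece I j,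
    Ideal.Quotient.mk I g * f₁ = Ideal.Quotient.mk I g * f₂ → f₁ = f₂

/-- Multiplication by `g` maps `(S/I)_j` onto `(S/I)_{j'}`. -/
def QSurj (I : Ideal (MvPolynomial (Fin n) K)) (g : MvPolynomial (Fin n) K)
    (j j' : ℕ) : Prop :=
  ∀ h ∈ Qpiece I j', ∃ f ∈ Qpiece I j, Ideal.Quotient.mk I g * f = h

/-- Multiplication by `g` from `(S/I)_j` to `(S/I)_{j'}` has maximal rank. -/
def MulMaxRank (I : Ideal (MvPolynomial (Fin n) K)) (g : MvPolynomial (Fin n) K)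
    (j j' : ℕ) : Prop :=
  QInj I g j j' ∨ QSurj I g j j'

/-- All exponent vectors of degree `j`. -/
def MM (n j : ℕ) : Finset (Fin n →₀ ℕ) := Finset.univ.finsuppAntidiag j

theorem mdeg_eq_sum {n : ℕ} (m : Fin n →₀ ℕ) : mdeg m = ∑ i, m i := by
  unfold mdeg
  exact Finsupp.sum_fintype _ _ (fun _ => rfl)

theorem mdeg_eq_degree {n : ℕ} (m : Fin n →₀ ℕ) : mdeg m = m.degree := by
  rw [mdeg_eq_sum, Finsupp.degree_eq_sum]

theorem mem_MM {n j : ℕ} (m : Fin n →₀ ℕ) : m ∈ MM n j ↔ mdeg m = j := by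
  simp [MM, mdeg_eq_sum]

theorem card_MM (N j : ℕ) : (MM (N + 1) j).card = Nat.choose (N + j) j := by
  rw [MM, Finset.card_finsuppAntidiag_nat_eq_choose]
  simp only [Finset.card_univ, Fintype.card_fin]
  congr 1
  omega

theorem mdeg_add {n : ℕ} (a b : Fin n →₀ ℕ) : mdeg (a + b) = mdeg a + mdeg b := by
  simp [mdeg_eq_degree]

theorem mdeg_single {n : ℕ} (i : Fin n) (e : ℕ) : mdeg (Finsupp.single i e) = e := by
  simp [mdeg_eq_degree]

theorem mdeg_cons {n : ℕ} (e : ℕ) (a : Fin n →₀ ℕ) : mdeg (Finsupp.cons e a) = e + mdeg a := by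
  simp [mdeg_eq_sum, Fin.sum_univ_succ]

/-- shift by a variable is injective -/
noncomputable def shiftEmb {n : ℕ} (i : Fin n) : (Fin n →₀ ℕ) ↪ (Fin n →₀ ℕ) :=
  ⟨fun m => m + Finsupp.single i 1, fun a b h => by simpa using h⟩

/-- adding a zero exponent in front -/
noncomputable def consEmb (n : ℕ) : (Fin n →₀ ℕ) ↪ (Fin (n + 1) →₀ ℕ) :=
  ⟨fun m => Finsupp.cons 0 m, Finsupp.cons_right_injective 0⟩

theorem shiftEmb_apply {n : ℕ} (i : Fin n) (m : Fin n →₀ ℕ) :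
    shiftEmb i m = m + Finsupp.single i 1 := rfl

theorem exists_shift {n : ℕ} (i : Fin n) (m : Fin n →₀ ℕ) (h : m i ≠ 0) :
    ∃ m', m = m' + Finsupp.single i 1 := by
  refine ⟨m - Finsupp.single i 1, ?_⟩
  rw [tsub_add_cancel_of_le]
  simpa using Nat.one_le_iff_ne_zero.mpr h

theorem exists_cons {n : ℕ} (m : Fin (n + 1) →₀ ℕ) (h : m 0 = 0) :
    ∃ m', m = Finsupp.cons 0 m' := by
  refine ⟨m.tail, ?_⟩
  rw [← h, Finsupp.cons_tail]

theorem card_MM_last (N j : ℕ) :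
    ((MM (N + 1) (j + 1)).filter (fun m => m (Fin.last N) ≠ 0)).card = Nat.choose (N + j) j := by
  rw [← card_MM, ← Finset.card_map (s := MM (N + 1) j) (shiftEmb (Fin.last N))]
  congr 1
  ext m
  simp only [Finset.mem_filter, Finset.mem_map, mem_MM, shiftEmb_apply]
  constructor
  · rintro ⟨h1, h2⟩
    obtain ⟨m', rfl⟩ := exists_shift _ _ h2
    refine ⟨m', ?_, rfl⟩
    rw [mdeg_add, mdeg_single] at h1
    omega
  · rintro ⟨m', h, rfl⟩
    refine ⟨?_, ?_⟩
    · rw [mdeg_add, mdeg_single, h]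
    · simp

/-- lower sets -/
def IsLow {n : ℕ} (j : ℕ) (B : Finset (Fin n →₀ ℕ)) : Prop :=
  (∀ u ∈ B, mdeg u = j) ∧ ∀ u ∈ B, ∀ v, mdeg v = j → lexLt v u → v ∈ B

theorem lexLt_trich {n : ℕ} (u v : Fin n →₀ ℕ) : u = v ∨ lexLt u v ∨ lexLt v u := by
  rcases lt_trichotomy (toLex (u : Fin n → ℕ)) (toLex (v : Fin n → ℕ)) with h | h | h
  · right; left
    obtain ⟨i, h1, h2⟩ := h
    exact ⟨i, h1, h2⟩
  · left
    exact DFunLike.coe_injective (toLex.injective h)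
  · right; right
    obtain ⟨i, h1, h2⟩ := h
    exact ⟨i, h1, h2⟩

theorem IsLow.eq {n j : ℕ} {B C : Finset (Fin n →₀ ℕ)} (hB : IsLow j B) (hC : IsLow j C)
    (h : B.card = C.card) : B = C := by
  by_cases hs : B ⊆ C
  · exact Finset.eq_of_subset_of_card_le hs h.ge
  · obtain ⟨u, hu, hu'⟩ := Finset.not_subset.mp hs
    symm
    refine Finset.eq_of_subset_of_card_le ?_ h.le
    intro v hv
    rcases lexLt_trich u v with rfl | h1 | h1
    · exact hu
    · exact absurd (hC.2 v hv u (hB.1 u hu) h1) hu'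
    · exact hB.2 u hu v (hC.1 v hv) h1

theorem lexLt_cons {n : ℕ} (a b : Fin n →₀ ℕ)
    (h : lexLt (Finsupp.cons 0 a) (Finsupp.cons 0 b)) : lexLt a b := by
  obtain ⟨i, h1, h2⟩ := h
  induction i using Fin.cases with
  | zero => simp at h2
  | succ i =>
    refine ⟨i, fun t ht => ?_, by simpa using h2⟩
    simpa using h1 t.succ (by simpa using ht)

theorem lexLt_shift {n : ℕ} (i : Fin n) (a b : Fin n →₀ ℕ)
    (h : lexLt (a + Finsupp.single i 1) (b + Finsupp.single i 1)) : lexLt a b := by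
  obtain ⟨l, h1, h2⟩ := h
  exact ⟨l, fun t ht => by simpa using h1 t ht, by simpa using h2⟩

theorem lexLt_zero {n : ℕ} (a b : Fin (n + 1) →₀ ℕ) (h : lexLt a b) (hb : b 0 = 0) : a 0 = 0 := by
  obtain ⟨l, h1, h2⟩ := h
  rcases Fin.eq_zero_or_eq_succ l with rfl | ⟨t, rfl⟩
  · omega
  · rw [h1 0 (Fin.succ_pos t), hb]

theorem exists_low (N : ℕ) : ∀ (j : ℕ) (k : Fin j → ℕ), StrictMono k → (∀ i, k i ≤ N + i) →
    ∃ B : Finset (Fin (N + 1) →₀ ℕ), IsLow j B ∧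
      B.card = ∑ i : Fin j, Nat.choose (k i) (i.val + 1) ∧
      (B.filter (fun m => m (Fin.last N) ≠ 0)).card =
        ∑ i : Fin j, (if k i = 0 then 0 else Nat.choose (k i - 1) i.val) := by
  induction N with
  | zero =>
    intro j k hk hb
    refine ⟨∅, ⟨by simp, by simp⟩, ?_, ?_⟩
    · symm
      simp only [Finset.card_empty, Finset.sum_eq_zero_iff, Finset.mem_univ, true_imp_iff]
      intro i
      apply Nat.choose_eq_zero_of_lt
      have := hb i
      omega
    · symm
      simp only [Finset.filter_empty, Finset.card_empty, Finset.sum_eq_zero_iff, Finset.mem_univ,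
        true_imp_iff]
      intro i
      have := hb i
      split_ifs with h
      · rfl
      · apply Nat.choose_eq_zero_of_lt
        omega
  | succ N ihN =>
    intro j
    induction j with
    | zero =>
      intro k hk hb
      exact ⟨∅, ⟨by simp, by simp⟩, by simp, by simp⟩
    | succ j ihj =>
      intro k hk hb
      by_cases htop : k (Fin.last j) ≤ N + j
      · have hb' : ∀ i, k i ≤ N + i := by
          intro i
          induction i using Fin.reverseInduction with
          | last => simpa using htop
          | cast i ih =>
            have := hk (Fin.castSucc_lt_succ (i := i))
            simp only [Fin.val_succ, Fin.val_castSucc] at *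
            omega
        obtain ⟨B, hB, h1, h2⟩ := ihN (j + 1) k hk hb'
        refine ⟨B.map (consEmb _), ⟨?_, ?_⟩, ?_, ?_⟩
        · intro u hu
          obtain ⟨u', hu', rfl⟩ := Finset.mem_map.mp hu
          have := hB.1 u' hu'
          simp [consEmb, mdeg_cons, this]
        · intro u hu v hv hvu
          obtain ⟨u', hu', rfl⟩ := Finset.mem_map.mp hu
          obtain ⟨v', rfl⟩ := exists_cons v (lexLt_zero _ _ hvu (by simp [consEmb]))
          refine Finset.mem_map.mpr ⟨v', ?_, rfl⟩
          refine hB.2 u' hu' v' ?_ (lexLt_cons _ _ hvu)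
          simpa [mdeg_cons] using hv
        · rw [Finset.card_map, h1]
        · rw [Finset.filter_map, Finset.card_map, ← h2]
          congr 1
      · have htop' : k (Fin.last j) = N + 1 + j := by
          have := hb (Fin.last j)
          simp only [Fin.val_last] at this
          omega
        obtain ⟨B, hB, h1, h2⟩ := ihj (fun i => k i.castSucc)
          (hk.comp (Fin.strictMono_castSucc)) (fun i => by simpa using hb i.castSucc)
        have hdisj : Disjoint ((MM (N + 1) (j + 1)).map (consEmb _)) (B.map (shiftEmb 0)) := by
          rw [Finset.disjoint_left]
          intro a ha hb
          obtain ⟨u, hu, rfl⟩ := Finset.mem_map.mp ha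
          obtain ⟨v, hv, hvu⟩ := Finset.mem_map.mp hb
          have := DFunLike.congr_fun hvu 0
          simp [consEmb, shiftEmb_apply] at this
        have hzero : ∀ v : Fin (N + 1 + 1) →₀ ℕ, mdeg v = j + 1 → v 0 = 0 →
            v ∈ (MM (N + 1) (j + 1)).map (consEmb _) := by
          intro v hv h0
          obtain ⟨v', rfl⟩ := exists_cons v h0
          refine Finset.mem_map.mpr ⟨v', ?_, rfl⟩
          rw [mem_MM]
          simpa [mdeg_cons] using hv
        refine ⟨((MM (N + 1) (j + 1)).map (consEmb _)).disjUnion (B.map (shiftEmb 0)) hdisj,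
          ⟨?_, ?_⟩, ?_, ?_⟩
        · intro u hu
          rcases Finset.mem_disjUnion.mp hu with hu | hu
          · obtain ⟨u', hu', rfl⟩ := Finset.mem_map.mp hu
            rw [mem_MM] at hu'
            simp [consEmb, mdeg_cons, hu']
          · obtain ⟨u', hu', rfl⟩ := Finset.mem_map.mp hu
            simp [shiftEmb_apply, mdeg_add, mdeg_single, hB.1 u' hu']
        · intro u hu v hv hvu
          rw [Finset.mem_disjUnion]
          by_cases h0 : v 0 = 0
          · exact Or.inl (hzero v hv h0)
          · right
            rcases Finset.mem_disjUnion.mp hu with hu | hu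
            · obtain ⟨u', hu', rfl⟩ := Finset.mem_map.mp hu
              exact absurd (lexLt_zero _ _ hvu (by simp [consEmb])) h0
            · obtain ⟨u', hu', rfl⟩ := Finset.mem_map.mp hu
              obtain ⟨v', rfl⟩ := exists_shift _ _ h0
              refine Finset.mem_map.mpr ⟨v', ?_, rfl⟩
              refine hB.2 u' hu' v' ?_ (lexLt_shift _ _ _ hvu)
              rw [mdeg_add, mdeg_single] at hv
              omega
        · rw [Finset.card_disjUnion, Finset.card_map, Finset.card_map, card_MM, h1,
            Fin.sum_univ_castSucc, htop', add_comm]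
          simp only [Fin.val_castSucc, Fin.val_last]
          congr 2
          omega
        · rw [Finset.filter_disjUnion, Finset.card_disjUnion, Finset.filter_map, Finset.card_map,
            Finset.filter_map, Finset.card_map, Fin.sum_univ_castSucc, htop', add_comm]
          simp only [Fin.val_castSucc, Fin.val_last]
          rw [← h2]
          congr 1
          · congr 1
            ext m
            simp [shiftEmb_apply]
          · rw [if_neg (by omega), show N + 1 + j - 1 = N + j by omega, ← card_MM_last]
            congr 1

open Classical in
theorem finrank_Qpiece (I : Ideal (MvPolynomial (Fin n) K)) (hI : IsMonomialIdeal I) (j : ℕ) :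
    Module.finrank K (Qpiece I j) =
      ((MM n j).filter (fun m => monomial m (1 : K) ∉ I)).card := by
  set C := (MM n j).filter (fun m => monomial m (1 : K) ∉ I) with hC
  let b : C → (MvPolynomial (Fin n) K ⧸ I) := fun m => Ideal.Quotient.mk I (monomial m.1 1)
  have hli : LinearIndependent K b := by
    rw [Fintype.linearIndependent_iff]
    intro g hg i
    by_contra hgi
    have hmem : (∑ m : C, monomial m.1 (g m) : MvPolynomial (Fin n) K) ∈ I := by
      rw [← Ideal.Quotient.eq_zero_iff_mem, ← hg, map_sum]
      refine Finset.sum_congr rfl fun m _ => ?_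
      have : (monomial m.1 (g m) : MvPolynomial (Fin n) K) = g m • monomial m.1 1 := by
        rw [smul_monomial, smul_eq_mul, mul_one]
      rw [this]
      exact map_smul (Ideal.Quotient.mkₐ K I) (g m) (monomial m.1 (1 : K))
    have hi := hI _ hmem i.1 (by
      rw [mem_support_iff, coeff_sum, Finset.sum_eq_single i]
      · simpa using hgi
      · intro c _ hc
        rw [coeff_monomial, if_neg (fun h => hc (Subtype.ext h))]
      · simp)
    exact (Finset.mem_filter.mp i.2).2 hi
  have hspan : Qpiece I j = Submodule.span K (Set.range b) := by
    unfold Qpiece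
    have hs : homogeneousSubmodule (Fin n) K j =
        Submodule.span K ((fun m => monomial m (1 : K)) '' {d | Finsupp.degree d = j}) := by
      rw [homogeneousSubmodule_eq_finsupp_supported, AddMonoidAlgebra.supported_eq_span_single]
      rfl
    rw [hs, Submodule.map_span]
    apply le_antisymm
    · rw [Submodule.span_le]
      rintro _ ⟨_, ⟨m, hm, rfl⟩, rfl⟩
      by_cases h : monomial m (1 : K) ∈ I
      · have : (Ideal.Quotient.mkₐ K I).toLinearMap (monomial m (1 : K)) = 0 :=
          Ideal.Quotient.eq_zero_iff_mem.mpr h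
        simp only [this]
        exact Submodule.zero_mem _
      · apply Submodule.subset_span
        refine ⟨⟨m, ?_⟩, rfl⟩
        rw [hC, Finset.mem_filter, mem_MM, mdeg_eq_degree]
        exact ⟨hm, h⟩
    · rw [Submodule.span_le]
      rintro _ ⟨m, rfl⟩
      apply Submodule.subset_span
      refine ⟨_, ⟨m.1, ?_, rfl⟩, rfl⟩
      have := (Finset.mem_filter.mp m.2).1
      rwa [mem_MM, mdeg_eq_degree] at this
  rw [hspan, finrank_span_eq_card hli, Fintype.card_coe]

/-- For a lexsegment ideal `I` with `I_j ≠ 0` (`j > 0`, `n ≥ 2`), the number of monomials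
in `I_j` divisible by `x_n` equals `H(S,j-1) - H(S/I,j)^{[j]}`. The Macaulay
representation of `a = H(S/I,j)` is supplied by the strictly increasing function `k`
(with `k i` encoding `k(i+1)`), and
`a^{[j]} = ∑ C(k(i) - 1, i - 1)`, where a term with `k(i) = 0` is zero. -/
theorem stmt_8 (hn : 2 ≤ n) (I : Ideal (MvPolynomial (Fin n) K))
    (hlex : IsLexsegmentIdeal I)
    (j : ℕ) (hj : 0 < j)
    (hIj : ∃ m : Fin n →₀ ℕ, mdeg m = j ∧ monomial m (1 : K) ∈ I)
    (k : Fin j → ℕ) (hk : StrictMono k)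
    (hrep : Module.finrank K (Qpiece I j) = ∑ i : Fin j, Nat.choose (k i) (i.val + 1)) :
    Nat.card {m : Fin n →₀ ℕ //
        mdeg m = j ∧ monomial m (1 : K) ∈ I ∧ m ⟨n - 1, by omega⟩ ≠ 0} =
      Nat.choose (n + j - 2) (j - 1) -
        ∑ i : Fin j, (if k i = 0 then 0 else Nat.choose (k i - 1) i.val) := by
  classical
  obtain ⟨N, rfl⟩ : ∃ N, n = N + 1 := ⟨n - 1, by omega⟩
  obtain ⟨j, rfl⟩ : ∃ J, j = J + 1 := ⟨j - 1, by omega⟩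
  rw [finrank_Qpiece I hlex.1] at hrep
  set C := (MM (N + 1) (j + 1)).filter (fun m => monomial m (1 : K) ∉ I) with hC
  have hClow : IsLow (j + 1) C := by
    refine ⟨fun u hu => (mem_MM u).mp (Finset.mem_filter.mp hu).1, fun u hu v hv hvu => ?_⟩
    obtain ⟨hu1, hu2⟩ := Finset.mem_filter.mp hu
    rw [mem_MM] at hu1
    refine Finset.mem_filter.mpr ⟨(mem_MM v).mpr hv, fun hvI => hu2 ?_⟩
    exact hlex.2 v u hvI (by rw [hu1, hv]) hvu
  have hlt : C.card < Nat.choose (N + (j + 1)) (j + 1) := by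
    rw [← card_MM]
    apply Finset.card_lt_card
    rw [Finset.filter_ssubset]
    obtain ⟨m, hm, hmI⟩ := hIj
    exact ⟨m, (mem_MM m).mpr hm, not_not.mpr hmI⟩
  have htop : k (Fin.last j) ≤ N + j := by
    by_contra hcon
    have h1 : Nat.choose (k (Fin.last j)) (j + 1) ≤
        ∑ i : Fin (j + 1), Nat.choose (k i) (i.val + 1) :=
      Finset.single_le_sum (f := fun i : Fin (j + 1) => Nat.choose (k i) (i.val + 1))
        (fun _ _ => Nat.zero_le _) (Finset.mem_univ (Fin.last j))
    have h2 : Nat.choose (N + (j + 1)) (j + 1) ≤ Nat.choose (k (Fin.last j)) (j + 1) :=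
      Nat.choose_le_choose _ (by omega)
    omega
  have hb : ∀ i, k i ≤ N + i := by
    intro i
    induction i using Fin.reverseInduction with
    | last => simpa using htop
    | cast i ih =>
      have := hk (Fin.castSucc_lt_succ (i := i))
      simp only [Fin.val_succ, Fin.val_castSucc] at *
      omega
  obtain ⟨B, hB, h1, h2⟩ := exists_low N (j + 1) k hk hb
  obtain rfl : B = C := hB.eq hClow (by rw [h1, hrep])
  rw [← h2, show N + 1 + (j + 1) - 2 = N + j by omega, show j + 1 - 1 = j by omega,
    ← card_MM_last]
  have hcard : Nat.card {m : Fin (N + 1) →₀ ℕ //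
        mdeg m = j + 1 ∧ monomial m (1 : K) ∈ I ∧ m ⟨N + 1 - 1, by omega⟩ ≠ 0} =
      (((MM (N + 1) (j + 1)).filter (fun m => m (Fin.last N) ≠ 0)).filter
        (fun m => monomial m (1 : K) ∈ I)).card := by
    rw [← Nat.card_eq_finsetCard]
    refine Nat.card_congr (Equiv.subtypeEquivRight fun m => ?_)
    simp only [Finset.mem_filter, mem_MM]
    have : (⟨N + 1 - 1, by omega⟩ : Fin (N + 1)) = Fin.last N := rfl
    rw [this]
    tauto
  have hsplit := Finset.card_filter_add_card_filter_not
    (s := (MM (N + 1) (j + 1)).filter (fun m => m (Fin.last N) ≠ 0))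
    (fun m => monomial m (1 : K) ∈ I)
  have hcomm : (C.filter (fun m => m (Fin.last N) ≠ 0)).card =
      (((MM (N + 1) (j + 1)).filter (fun m => m (Fin.last N) ≠ 0)).filter
        (fun m => ¬ monomial m (1 : K) ∈ I)).card := by
    congr 1
    ext m
    simp only [hC, Finset.mem_filter]
    tauto
  rw [hcard, hcomm, ← hsplit, Nat.add_sub_cancel_right]
end

section
/- Let $K$ be a field of characteristic $p > 0$ and $S = K[x_1, x_2, x_3]$. Let $M = \{x_1^{\nu_1} x_2^{\nu_2} x_3^{\nu_3} : \nu_1 + \nu_2 + \nu_3 = 2p,\ \nu_3 < p\}$ and $I = (M, x_1^p x_3^p, x_2^p x_3^p)$. Then $I$ is stable but not strongly stable. -/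
open MvPolynomial

variable {K : Type*} [Field K] {n : ℕ}

theorem mem_aux (p : ℕ) (hp : 0 < p)
    (I : Ideal (MvPolynomial (Fin 3) K))
    (hI : I = Ideal.span
      ({f : MvPolynomial (Fin 3) K | ∃ m : Fin 3 →₀ ℕ,
          f = monomial m (1 : K) ∧ m 0 + m 1 + m 2 = 2 * p ∧ m 2 < p} ∪
        {X 0 ^ p * X 2 ^ p, X 1 ^ p * X 2 ^ p})) (m : Fin 3 →₀ ℕ) :
    monomial m (1 : K) ∈ I ↔
      (2 * p ≤ m 0 + m 1 + min (m 2) (p - 1) ∨ (p ≤ m 0 ∧ p ≤ m 2) ∨ (p ≤ m 1 ∧ p ≤ m 2)) := by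
  have hX : ∀ i j : Fin 3, (X i ^ p * X j ^ p : MvPolynomial (Fin 3) K) =
      monomial (Finsupp.single i p + Finsupp.single j p) 1 := by
    intro i j
    simp [X_pow_eq_monomial, monomial_mul]
  have hI' : I = Ideal.span ((fun s : Fin 3 →₀ ℕ => monomial s (1 : K)) ''
      ({s : Fin 3 →₀ ℕ | s 0 + s 1 + s 2 = 2 * p ∧ s 2 < p} ∪
        {Finsupp.single 0 p + Finsupp.single 2 p, Finsupp.single 1 p + Finsupp.single 2 p})) := by
    rw [hI, Set.image_union, Set.image_pair, hX, hX]
    congr 2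
    ext f
    constructor
    · rintro ⟨s, rfl, h⟩
      exact ⟨s, h, rfl⟩
    · rintro ⟨s, h, rfl⟩
      exact ⟨s, rfl, h⟩
  rw [hI', mem_ideal_span_monomial_image]
  have hs : (monomial m (1 : K)).support = {m} := by
    classical
    rw [support_monomial, if_neg one_ne_zero]
  rw [hs]
  simp only [Finset.mem_singleton, forall_eq]
  constructor
  · rintro ⟨s, hs | hs | hs, hle⟩
    · obtain ⟨h1, h2⟩ := hs
      have a := hle 0
      have b := hle 1
      have c := hle 2
      left
      omega
    · subst hs
      have a := hle 0
      have c := hle 2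
      simp at a c
      right; left; exact ⟨a, c⟩
    · subst hs
      have a := hle 1
      have c := hle 2
      simp at a c
      right; right; exact ⟨a, c⟩
  · rintro (h | h | h)
    · obtain ⟨a, b, c, ha, hb, hc, h1, h2⟩ : ∃ a b c : ℕ, a ≤ m 0 ∧ b ≤ m 1 ∧ c ≤ m 2 ∧
          a + b + c = 2 * p ∧ c < p := by
        refine ⟨min (m 0) (2 * p - min (m 2) (p - 1)),
          2 * p - min (m 2) (p - 1) - min (m 0) (2 * p - min (m 2) (p - 1)),
          min (m 2) (p - 1), ?_, ?_, ?_, ?_, ?_⟩ <;> omega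
      refine ⟨Finsupp.equivFunOnFinite.symm ![a, b, c], Or.inl ⟨by simpa using h1, by simpa using h2⟩, ?_⟩
      intro i
      fin_cases i <;> simpa
    · refine ⟨_, Or.inr (Or.inl rfl), ?_⟩
      intro i
      fin_cases i <;> simp [h.1, h.2]
    · refine ⟨_, Or.inr (Or.inr rfl), ?_⟩
      intro i
      fin_cases i <;> simp [h.1, h.2]

/-- In characteristic `p > 0`, with
`M = {x₁^{ν₁} x₂^{ν₂} x₃^{ν₃} : ν₁+ν₂+ν₃ = 2p, ν₃ < p}`, the ideal
`I = (M, x₁^p x₃^p, x₂^p x₃^p)` of `K[x₁,x₂,x₃]` is stable but not strongly stable. -/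
theorem stmt_12 (p : ℕ) (hp : 0 < p) [CharP K p]
    (I : Ideal (MvPolynomial (Fin 3) K))
    (hI : I = Ideal.span
      ({f : MvPolynomial (Fin 3) K | ∃ m : Fin 3 →₀ ℕ,
          f = monomial m (1 : K) ∧ m 0 + m 1 + m 2 = 2 * p ∧ m 2 < p} ∪
        {X 0 ^ p * X 2 ^ p, X 1 ^ p * X 2 ^ p})) :
    IsStableIdeal I ∧ ¬ IsStronglyStableIdeal I := by
  have hp1 : p ≠ 1 := CharP.char_ne_one K p
  have key := mem_aux p hp I hI
  constructor
  · intro m hm k i hk hk' hik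
    rw [key] at hm ⊢
    fin_cases k
    · fin_cases i
      · simpa using hm
      · simp at hik
      · simp at hik
    · have h2 := hk' 2 (by decide)
      fin_cases i
      · simp at hk hm ⊢
        omega
      · simpa using hm
      · simp at hik
    · fin_cases i
      · simp at hk hm ⊢
        omega
      · simp at hk hm ⊢
        omega
      · simpa using hm
  · intro h
    have := h (Finsupp.single 1 p + Finsupp.single 2 p) (by rw [key]; simp) 1 0
      (by simp; omega) (by decide)
    rw [key] at this
    simp at this
    omega
end
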